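/- There exists a topology τ on [ω]^ω such that a set S ⊆ [ω]^ω has the Baire property with respect to τ (i.e. S differs from a τ-open set by a τ-meager set) if and only if S is a v-set. -/

import Mathlib

open Set

/-- `A`, `B` form a segment when `A ⊆ B` and `B \ A` is infinite. -/
def IsSeg (A B : Set ℕ) : Prop := A ⊆ B ∧ (B \ A).Infinite

/-- The segment `⟨A,B⟩ = {X ∈ [ω]^ω : A ⊆ X ⊆ B}`. -/
def Seg (A B : Set ℕ) : Set (Set ℕ) := {X | X.Infinite ∧ A ⊆ X ∧ X ⊆ B}

/-- `X ⊆* Y` : the set `X \ Y` is finite. -/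
def AlmostSub (X Y : Set ℕ) : Prop := (X \ Y).Finite

/-- The *-segment `⟨A,B⟩* = {X ∈ [ω]^ω : A ⊆* X ⊆* B}`. -/
def StarSeg (A B : Set ℕ) : Set (Set ℕ) := {X | X.Infinite ∧ AlmostSub A X ∧ AlmostSub X B}

/-- `S` is a v⁰-set: every segment contains a segment disjoint from `S`. -/
def IsVZero (S : Set (Set ℕ)) : Prop :=
  ∀ A B, IsSeg A B → ∃ C D, IsSeg C D ∧ Seg C D ⊆ Seg A B ∧ Seg C D ∩ S = ∅

/-- `S` is a v-set: every segment contains a segment inside `S` or disjoint from `S`. -/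
def IsVSet (S : Set (Set ℕ)) : Prop :=
  ∀ A B, IsSeg A B → ∃ C D, IsSeg C D ∧ Seg C D ⊆ Seg A B ∧
    (Seg C D ⊆ S ∨ Seg C D ∩ S = ∅)

theorem IsSeg.nonempty_seg {A B : Set ℕ} (h : IsSeg A B) : (Seg A B).Nonempty :=
  ⟨B, h.2.mono sdiff_subset, h.1, subset_rfl⟩

theorem seg_subset_seg {A B C D : Set ℕ} (hA : A ⊆ C) (hD : D ⊆ B) : Seg C D ⊆ Seg A B :=
  fun _ hX => ⟨hX.1, hA.trans hX.2.1, hX.2.2.trans hD⟩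

theorem IsSeg.subset_of_seg_subset {A B C D : Set ℕ} (h : IsSeg C D) (hs : Seg C D ⊆ Seg A B) :
    A ⊆ C ∧ D ⊆ B := by
  have hD : D.Infinite := h.2.mono sdiff_subset
  refine ⟨fun x hx => ?_, (hs ⟨hD, h.1, subset_rfl⟩).2.2⟩
  by_contra hxC
  have hmem : D \ {x} ∈ Seg C D :=
    ⟨hD.sdiff (finite_singleton x), fun y hy => ⟨h.1 hy, fun e => hxC (e ▸ hy)⟩, sdiff_subset⟩
  exact ((hs hmem).2.1 hx).2 rfl

theorem IsVZero.mono {S T : Set (Set ℕ)} (hT : IsVZero T) (h : S ⊆ T) : IsVZero S := by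
  intro A B hAB
  obtain ⟨C, D, hCD, hs, hd⟩ := hT A B hAB
  exact ⟨C, D, hCD, hs, subset_eq_empty (inter_subset_inter_right _ h) hd⟩

/-- A segment can be shrunk to avoid a `v⁰`-set while keeping finitely many points free. -/
theorem IsVZero.exists_seg_keeping_free {S : Set (Set ℕ)} (hS : IsVZero S) (F : Finset ℕ) :
    ∀ A B, IsSeg A B → (F : Set ℕ) ⊆ B \ A →
      ∃ C D, IsSeg C D ∧ A ⊆ C ∧ D ⊆ B ∧ (F : Set ℕ) ⊆ D \ C ∧ Seg C D ∩ S = ∅ := by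
  induction F using Finset.induction_on with
  | empty =>
    intro A B hAB _
    obtain ⟨C, D, hCD, hs, hd⟩ := hS A B hAB
    obtain ⟨h1, h2⟩ := hCD.subset_of_seg_subset hs
    exact ⟨C, D, hCD, h1, h2, by simp, hd⟩
  | insert x F hxF ih =>
    intro A B hAB hF
    have hx : x ∈ B \ A := hF (by simp)
    have hF' : ∀ y ∈ F, y ∈ B ∧ y ∉ A := fun y hy => hF (by simp [hy])
    have hne : ∀ y ∈ F, y ≠ x := fun y hy e => hxF (e ▸ hy)
    have hseg : IsSeg (insert x A) B := by
      refine ⟨insert_subset hx.1 hAB.1, ?_⟩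
      refine (hAB.2.sdiff (finite_singleton x)).mono fun y hy => ⟨hy.1.1, ?_⟩
      rintro (h | h)
      exacts [hy.2 h, hy.1.2 h]
    obtain ⟨C, D, hCD, hAC, hDB, hFCD, hd⟩ := ih (insert x A) B hseg fun y hy =>
      ⟨(hF' y hy).1, by rintro (h | h); exacts [hne y hy h, (hF' y hy).2 h]⟩
    have hxC : x ∈ C := hAC (mem_insert _ _)
    have hseg' : IsSeg (C \ {x}) (D \ {x}) := by
      refine ⟨sdiff_subset_sdiff_left hCD.1, ?_⟩
      refine (hCD.2.sdiff (finite_singleton x)).mono fun y hy => ⟨⟨hy.1.1, hy.2⟩, fun h => hy.1.2 h.1⟩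
    obtain ⟨C', D', hCD', hCC', hDD', hF2, hd'⟩ := ih _ _ hseg' fun y hy =>
      ⟨⟨(hFCD hy).1, hne y hy⟩, fun h => (hFCD hy).2 h.1⟩
    have hxD' : x ∉ D' := fun h => (hDD' h).2 rfl
    have hxC' : x ∉ C' := fun h => hxD' (hCD'.1 h)
    refine ⟨C', insert x D', ⟨hCD'.1.trans (subset_insert _ _),
      hCD'.2.mono (sdiff_subset_sdiff_left (subset_insert _ _))⟩, ?_, ?_, ?_, ?_⟩
    · exact fun y hy => hCC' ⟨hAC (mem_insert_of_mem _ hy), fun e => hx.2 (e ▸ hy)⟩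
    · exact insert_subset hx.1 (fun y hy => hDB (hDD' hy).1)
    · intro y hy
      rcases Finset.mem_insert.1 hy with rfl | hy
      · exact ⟨mem_insert _ _, hxC'⟩
      · exact ⟨mem_insert_of_mem _ (hF2 hy).1, (hF2 hy).2⟩
    · rw [eq_empty_iff_forall_notMem] at hd hd' ⊢
      rintro X ⟨⟨hX, h1, h2⟩, hXS⟩
      by_cases hxX : x ∈ X
      · refine hd X ⟨⟨hX, fun y hy => ?_, fun y hy => ?_⟩, hXS⟩
        · by_cases e : y = x
          · exact e ▸ hxX
          · exact h1 (hCC' ⟨hy, e⟩)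
        · rcases h2 hy with rfl | h
          exacts [hCD.1 hxC, (hDD' h).1]
      · exact hd' X ⟨⟨hX, h1, fun y hy => (h2 hy).resolve_left fun e => hxX (e ▸ hy)⟩, hXS⟩

theorem IsVZero.iUnion {S : ℕ → Set (Set ℕ)} (hS : ∀ n, IsVZero (S n)) :
    IsVZero (⋃ n, S n) := by
  intro A B hAB
  let σ := {t : Set ℕ × Set ℕ × Finset ℕ // IsSeg t.1 t.2.1 ∧ (t.2.2 : Set ℕ) ⊆ t.2.1 \ t.1}
  have step : ∀ (n : ℕ) (t : σ), ∃ u : σ, t.1.1 ⊆ u.1.1 ∧ u.1.2.1 ⊆ t.1.2.1 ∧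
      t.1.2.2 ⊂ u.1.2.2 ∧ Seg u.1.1 u.1.2.1 ∩ S n = ∅ := by
    rintro n ⟨⟨A, B, F⟩, hAB, hF⟩
    obtain ⟨C, D, hCD, hAC, hDB, hFCD, hd⟩ := (hS n).exists_seg_keeping_free F A B hAB hF
    obtain ⟨x, hx, hxF⟩ := hCD.2.exists_notMem_finset F
    refine ⟨⟨⟨C, D, insert x F⟩, hCD, ?_⟩, hAC, hDB, Finset.ssubset_insert hxF, hd⟩
    simpa [insert_subset_iff] using ⟨hx, hFCD⟩
  choose f hf1 hf2 hf3 hf4 using step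
  let t : ℕ → σ := fun n => n.rec ⟨⟨A, B, ∅⟩, hAB, by simp⟩ f
  have hA : Monotone fun n => (t n).1.1 := monotone_nat_of_le_succ fun n => hf1 n (t n)
  have hB : Antitone fun n => (t n).1.2.1 := antitone_nat_of_succ_le fun n => hf2 n (t n)
  have hF : StrictMono fun n => (t n).1.2.2 := strictMono_nat_of_lt_succ fun n => hf3 n (t n)
  have hFmem : ∀ n x, x ∈ (t n).1.2.2 → x ∈ (⋂ n, (t n).1.2.1) \ ⋃ n, (t n).1.1 := by
    intro n x hx
    have key : ∀ m, x ∈ (t m).1.2.1 \ (t m).1.1 := fun m =>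
      have h := (t (max n m)).2.2 (hF.monotone (le_max_left n m) hx)
      ⟨hB (le_max_right n m) h.1, fun hm => h.2 (hA (le_max_right n m) hm)⟩
    simp only [mem_sdiff, mem_iInter, mem_iUnion, not_exists]
    exact ⟨fun m => (key m).1, fun m => (key m).2⟩
  refine ⟨⋃ n, (t n).1.1, ⋂ n, (t n).1.2.1, ⟨?_, ?_⟩, ?_, ?_⟩
  · refine iUnion_subset fun n => subset_iInter fun m x hx => ?_
    exact hB (le_max_right n m) ((t (max n m)).2.1.1 (hA (le_max_left n m) hx))
  · intro hfin
    have hle : ∀ n, (t n).1.2.2 ⊆ hfin.toFinset := fun n x hx => by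
      rw [Finite.mem_toFinset]
      exact hFmem n x hx
    have hcard : StrictMono fun n => (t n).1.2.2.card :=
      fun a b hab => Finset.card_lt_card (hF hab)
    have h := (hcard.le_apply (x := hfin.toFinset.card + 1)).trans (Finset.card_le_card (hle (hfin.toFinset.card + 1)))
    omega
  · exact seg_subset_seg (subset_iUnion (fun n => (t n).1.1) 0)
      (iInter_subset (fun n => (t n).1.2.1) 0)
  · rw [eq_empty_iff_forall_notMem]
    rintro X ⟨hX, hXS⟩
    obtain ⟨n, hn⟩ := mem_iUnion.1 hXS
    have h : X ∈ Seg (t (n + 1)).1.1 (t (n + 1)).1.2.1 :=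
      seg_subset_seg (subset_iUnion (fun n => (t n).1.1) (n + 1))
        (iInter_subset (fun n => (t n).1.2.1) (n + 1)) hX
    exact eq_empty_iff_forall_notMem.1 (hf4 n (t n)) X ⟨h, hn⟩

theorem isVZero_empty : IsVZero ∅ := fun A B h => ⟨A, B, h, subset_rfl, inter_empty _⟩

theorem IsVZero.union {S T : Set (Set ℕ)} (hS : IsVZero S) (hT : IsVZero T) :
    IsVZero (S ∪ T) := by
  intro A B hAB
  obtain ⟨C, D, hCD, hs, hd⟩ := hS A B hAB
  obtain ⟨C', D', hCD', hs', hd'⟩ := hT C D hCD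
  refine ⟨C', D', hCD', hs'.trans hs, ?_⟩
  rw [inter_union_distrib_left, hd', union_empty]
  exact subset_eq_empty (inter_subset_inter_left _ hs') hd

/-- Every segment minus a `v⁰`-set contains a segment. -/
theorem IsVZero.exists_seg_subset {A B : Set ℕ} {S T : Set (Set ℕ)} (hAB : IsSeg A B)
    (hS : IsVZero S) (h : Seg A B \ S ⊆ T) : ∃ C D, IsSeg C D ∧ Seg C D ⊆ Seg A B ∧ Seg C D ⊆ T := by
  obtain ⟨C, D, hCD, hs, hd⟩ := hS A B hAB
  exact ⟨C, D, hCD, hs, fun X hX =>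
    h ⟨hs hX, fun hXS => eq_empty_iff_forall_notMem.1 hd X ⟨hX, hXS⟩⟩⟩

open Cardinal in
theorem isVZero_of_mk_lt_continuum {S : Set (Set ℕ)} (hS : #S < 𝔠) : IsVZero S := by
  intro A B hAB
  obtain ⟨E, F, hEF, hdisj, hcard⟩ := hAB.2.exists_union_disjoint_cardinal_eq_of_infinite
  have hinf : E.Infinite ∧ F.Infinite := by
    have hiff : E.Infinite ↔ F.Infinite := by
      rw [← infinite_coe_iff, ← infinite_coe_iff, infinite_iff, infinite_iff, hcard]
    have := hAB.2
    rw [← hEF, infinite_union] at this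
    tauto
  have hE : E ⊆ B \ A := hEF ▸ subset_union_left
  have hF : F ⊆ B \ A := hEF ▸ subset_union_right
  by_contra! hcon
  have hmeet : ∀ G : 𝒫 E, ∃ X ∈ S, X ∈ Seg (A ∪ G) (A ∪ G ∪ F) := by
    rintro ⟨G, hG⟩
    have hGE : G ⊆ E := hG
    obtain ⟨X, hX, hXS⟩ := hcon (A ∪ G) (A ∪ G ∪ F) ⟨subset_union_left, hinf.2.mono fun x hx =>
      ⟨Or.inr hx, fun h => h.elim (hF hx).2 fun h => hdisj.le_bot ⟨hGE h, hx⟩⟩⟩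
      (seg_subset_seg subset_union_left (union_subset (union_subset hAB.1
        fun x hx => (hE (hGE hx)).1) fun x hx => (hF hx).1))
    exact ⟨X, hXS, hX⟩
  choose g hgS hg using hmeet
  have hrec : ∀ G : 𝒫 E, g G ∩ E = G := by
    intro G
    have hGE : (G : Set ℕ) ⊆ E := G.2
    refine subset_antisymm (fun x hx => ?_) fun x hx => ⟨(hg G).2.1 (Or.inr hx), hGE hx⟩
    rcases (hg G).2.2 hx.1 with (h | h) | h
    · exact absurd h (hE hx.2).2
    · exact h
    · exact (hdisj.le_bot ⟨hx.2, h⟩).elim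
  have hinj : Function.Injective fun G : 𝒫 E => (⟨g G, hgS G⟩ : S) := by
    intro G H h
    apply Subtype.ext
    rw [← hrec G, ← hrec H, Subtype.mk.inj h]
  have hle := mk_le_of_injective hinj
  have : Infinite E := hinf.1.to_subtype
  rw [mk_powerset, mk_eq_aleph0 E, two_power_aleph0] at hle
  exact hS.not_ge hle

/-- If every nonempty open set contains a segment and every segment is open up to a `v⁰`-set, then
the nowhere dense sets are the `v⁰`-sets. -/
theorem isNowhereDense_iff_isVZero [TopologicalSpace {X : Set ℕ // X.Infinite}]
    (hopen : ∀ U : Set {X : Set ℕ // X.Infinite}, IsOpen U → U.Nonempty →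
      ∃ A B, IsSeg A B ∧ Seg A B ⊆ Subtype.val '' U)
    (hseg : ∀ A B, IsSeg A B → ∃ U : Set {X : Set ℕ // X.Infinite}, IsOpen U ∧
      Subtype.val '' U ⊆ Seg A B ∧ IsVZero (Seg A B \ Subtype.val '' U))
    (N : Set {X : Set ℕ // X.Infinite}) :
    IsNowhereDense N ↔ IsVZero (Subtype.val '' N) := by
  have hne : ∀ A B, IsSeg A B → ∀ U : Set {X : Set ℕ // X.Infinite},
      IsVZero (Seg A B \ Subtype.val '' U) → U.Nonempty := by
    intro A B hAB U hU
    obtain ⟨C, D, hCD, -, h⟩ := hU.exists_seg_subset hAB (T := Subtype.val '' U)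
      fun X hX => by_contra fun h => hX.2 ⟨hX.1, h⟩
    exact (hCD.nonempty_seg.mono h).of_image
  constructor
  · intro hN A B hAB
    obtain ⟨U, hU, hUs, hUv⟩ := hseg A B hAB
    have hsub : ¬ U ⊆ closure N := fun h => by
      have h2 := interior_maximal h hU
      rw [hN] at h2
      exact (hne A B hAB U hUv).ne_empty (subset_empty_iff.1 h2)
    obtain ⟨x, hx, hxN⟩ := not_subset.1 hsub
    obtain ⟨C, D, hCD, hs⟩ := hopen (U ∩ (closure N)ᶜ) (hU.inter isClosed_closure.isOpen_compl)
      ⟨x, hx, hxN⟩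
    refine ⟨C, D, hCD, hs.trans ((image_mono inter_subset_left).trans hUs), ?_⟩
    rw [eq_empty_iff_forall_notMem]
    rintro X ⟨hX, ⟨y, hy, rfl⟩⟩
    obtain ⟨z, hz, hzy⟩ := hs hX
    exact hz.2 (Subtype.ext hzy ▸ subset_closure hy)
  · intro hN
    rw [IsNowhereDense, ← not_nonempty_iff_eq_empty]
    intro hint
    obtain ⟨A, B, hAB, hs⟩ := hopen _ isOpen_interior hint
    obtain ⟨C, D, hCD, hs', hd⟩ := hN A B hAB
    obtain ⟨U, hU, hUs, hUv⟩ := hseg C D hCD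
    obtain ⟨x, hx⟩ := hne C D hCD U hUv
    have hxC : x ∈ closure N := by
      obtain ⟨z, hz, hzx⟩ := hs (hs' (hUs ⟨x, hx, rfl⟩))
      exact interior_subset (Subtype.ext hzx ▸ hz)
    obtain ⟨y, hyU, hyN⟩ := mem_closure_iff.1 hxC U hU hx
    exact eq_empty_iff_forall_notMem.1 hd y ⟨hUs ⟨y, hyU, rfl⟩, y, hyN, rfl⟩

/-- If every nonempty open set contains a segment and every segment is open up to a `v⁰`-set, then
the sets with the Baire property are the `v`-sets. -/
theorem baireProperty_iff_isVSet [TopologicalSpace {X : Set ℕ // X.Infinite}]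
    (hopen : ∀ U : Set {X : Set ℕ // X.Infinite}, IsOpen U → U.Nonempty →
      ∃ A B, IsSeg A B ∧ Seg A B ⊆ Subtype.val '' U)
    (hseg : ∀ A B, IsSeg A B → ∃ U : Set {X : Set ℕ // X.Infinite}, IsOpen U ∧
      Subtype.val '' U ⊆ Seg A B ∧ IsVZero (Seg A B \ Subtype.val '' U))
    (S : Set {X : Set ℕ // X.Infinite}) :
    (∃ U : Set {X : Set ℕ // X.Infinite}, IsOpen U ∧ IsMeagre (symmDiff S U)) ↔
      IsVSet (Subtype.val '' S) := by
  have hnwd := isNowhereDense_iff_isVZero hopen hseg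
  constructor
  · rintro ⟨U, hU, hM⟩
    have hv : IsVZero (Subtype.val '' symmDiff S U) := by
      obtain ⟨T, hT, hTc, hsub⟩ := isMeagre_iff_countable_union_isNowhereDense.1 hM
      obtain ⟨f, hf⟩ := (hTc.insert ∅).exists_eq_range (insert_nonempty _ _)
      refine (IsVZero.iUnion (S := fun n => Subtype.val '' f n) fun n => ?_).mono ?_
      · have : f n ∈ insert ∅ T := hf ▸ mem_range_self n
        rcases this with h | h
        · rw [h, image_empty]
          exact isVZero_empty
        · exact (hnwd _).1 (hT _ h)
      · rintro _ ⟨x, hx, rfl⟩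
        obtain ⟨t, ht, hxt⟩ := hsub hx
        obtain ⟨n, rfl⟩ : t ∈ range f := hf ▸ mem_insert_of_mem _ ht
        exact mem_iUnion.2 ⟨n, x, hxt, rfl⟩
    intro A B hAB
    obtain ⟨V, hV, hVs, hVv⟩ := hseg A B hAB
    rcases (V ∩ U).eq_empty_or_nonempty with he | hne
    · obtain ⟨C, D, hCD, hs, hd⟩ := (hVv.union hv) A B hAB
      refine ⟨C, D, hCD, hs, Or.inr ?_⟩
      rw [eq_empty_iff_forall_notMem] at hd he ⊢
      rintro _ ⟨hX, x, hxS, rfl⟩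
      have h1 : x ∉ symmDiff S U := fun h => hd _ ⟨hX, Or.inr ⟨x, h, rfl⟩⟩
      have hxU : x ∈ U := by_contra fun h => h1 (Or.inl ⟨hxS, h⟩)
      refine hd _ ⟨hX, Or.inl ⟨hs hX, ?_⟩⟩
      rintro ⟨y, hy, hyx⟩
      exact he x ⟨Subtype.ext hyx ▸ hy, hxU⟩
    · obtain ⟨C, D, hCD, hs⟩ := hopen _ (hV.inter hU) hne
      obtain ⟨C', D', hCD', hs', hd⟩ := hv C D hCD
      refine ⟨C', D', hCD', hs'.trans (hs.trans ((image_mono inter_subset_left).trans hVs)),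
        Or.inl fun X hX => ?_⟩
      obtain ⟨x, hx, rfl⟩ := hs (hs' hX)
      refine ⟨x, by_contra fun h => ?_, rfl⟩
      exact eq_empty_iff_forall_notMem.1 hd _ ⟨hX, x, Or.inr ⟨hx.2, h⟩, rfl⟩
  · intro hS
    let U : Set {X : Set ℕ // X.Infinite} := ⋃₀ {V | IsOpen V ∧ V ⊆ S}
    have hUS : U ⊆ S := sUnion_subset fun V hV => hV.2
    refine ⟨U, isOpen_sUnion fun V hV => hV.1, IsNowhereDense.isMeagre ((hnwd _).2 ?_)⟩
    intro A B hAB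
    obtain ⟨C, D, hCD, hs, h | h⟩ := hS A B hAB
    · obtain ⟨V, hV, hVs, hVv⟩ := hseg C D hCD
      have hVS : V ⊆ S := fun x hx => by
        obtain ⟨y, hy, hyx⟩ := h (hVs ⟨x, hx, rfl⟩)
        exact Subtype.ext hyx ▸ hy
      obtain ⟨C', D', hCD', hs', hd⟩ := hVv C D hCD
      refine ⟨C', D', hCD', hs'.trans hs, ?_⟩
      rw [eq_empty_iff_forall_notMem] at hd ⊢
      rintro _ ⟨hX, x, hx | hx, rfl⟩
      · refine hd _ ⟨hX, hs' hX, ?_⟩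
        rintro ⟨y, hy, hyx⟩
        exact hx.2 ⟨V, ⟨hV, hVS⟩, Subtype.ext hyx ▸ hy⟩
      · exact hx.2 (hUS hx.1)
    · refine ⟨C, D, hCD, hs, ?_⟩
      rw [eq_empty_iff_forall_notMem] at h ⊢
      rintro _ ⟨hX, x, hx | hx, rfl⟩
      · exact h _ ⟨hX, x, hx.1, rfl⟩
      · exact hx.2 (hUS hx.1)

theorem finite_seg {A B : Set ℕ} (h : (B \ A).Finite) : (Seg A B).Finite := by
  refine (h.powerset.image (A ∪ ·)).subset ?_
  rintro X ⟨-, hA, hB⟩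
  exact ⟨X \ A, sdiff_subset_sdiff_left hB, union_sdiff_cancel hA⟩

/-- The common lower end of finitely many pairs. -/
def segLower (s : Finset (Set ℕ × Set ℕ)) : Set ℕ := ⋃ q ∈ s, q.1

/-- The common upper end of finitely many pairs. -/
def segUpper (s : Finset (Set ℕ × Set ℕ)) : Set ℕ := ⋂ q ∈ s, q.2

theorem mem_seg_segLower_segUpper {s : Finset (Set ℕ × Set ℕ)} {X : Set ℕ} :
    X ∈ Seg (segLower s) (segUpper s) ↔ X.Infinite ∧ ∀ q ∈ s, X ∈ Seg q.1 q.2 := by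
  simp only [Seg, segLower, segUpper, mem_ofPred_eq, iUnion_subset_iff, subset_iInter_iff]
  exact ⟨fun h => ⟨h.1, fun q hq => ⟨h.1, h.2.1 q hq, h.2.2 q hq⟩⟩,
    fun h => ⟨h.1, fun q hq => (h.2 q hq).2.1, fun q hq => (h.2 q hq).2.2⟩⟩

section Ranking

variable {ι : Type*} [LinearOrder ι] (e : Set ℕ × Set ℕ → ι)

/-- The points lying in a degenerate intersection of finitely many segments that are ranked
at most as high as `p`. -/
def degeneratePoints (p : Set ℕ × Set ℕ) : Set (Set ℕ) :=
  ⋃ s : Finset {q // e q ≤ e p}, ⋃ _ : (segUpper (s.map (Function.Embedding.subtype _)) \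
    segLower (s.map (Function.Embedding.subtype _))).Finite,
      Seg (segLower (s.map (Function.Embedding.subtype _)))
        (segUpper (s.map (Function.Embedding.subtype _)))

open Cardinal in
theorem isVZero_degeneratePoints (p : Set ℕ × Set ℕ) (h : #{q // e q ≤ e p} < 𝔠) :
    IsVZero (degeneratePoints e p) := by
  have hfin : #(Finset {q // e q ≤ e p}) < 𝔠 := by
    rcases finite_or_infinite {q // e q ≤ e p} with _ | _
    · exact (lt_aleph0_of_finite _).trans aleph0_lt_continuum
    · rwa [mk_finset_of_infinite]
  refine isVZero_of_mk_lt_continuum ((mk_iUnion_le _).trans_lt ?_)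
  refine mul_lt_of_lt aleph0_le_continuum hfin (lt_of_le_of_lt (ciSup_le' fun s => ?_)
    aleph0_lt_continuum)
  refine le_aleph0_iff_set_countable.2 (countable_iUnion fun hs => (finite_seg hs).countable)

theorem infinite_of_notMem_degeneratePoints {p : Set ℕ × Set ℕ} {X : Set ℕ}
    (hX : X ∉ degeneratePoints e p) {s : Finset (Set ℕ × Set ℕ)} (hs : ∀ q ∈ s, e q ≤ e p)
    (hXs : X ∈ Seg (segLower s) (segUpper s)) : (segUpper s \ segLower s).Infinite := by
  intro hfin
  have hmap : (s.subtype fun q => e q ≤ e p).map (Function.Embedding.subtype _) = s :=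
    Finset.subtype_map_of_mem hs
  refine hX (mem_iUnion.2 ⟨s.subtype fun q => e q ≤ e p, mem_iUnion.2 ⟨?_, ?_⟩⟩) <;> rwa [hmap]

/-- The topology with a subbase of segments `p` from which `degeneratePoints e p` are removed. -/
@[reducible]
def segmentTopology : TopologicalSpace {X : Set ℕ // X.Infinite} where
  IsOpen U := ∀ X ∈ U, ∃ s : Finset (Set ℕ × Set ℕ),
    (∀ p ∈ s, X.1 ∈ Seg p.1 p.2 \ degeneratePoints e p) ∧
      ∀ Y : {X : Set ℕ // X.Infinite}, (∀ p ∈ s, Y.1 ∈ Seg p.1 p.2 \ degeneratePoints e p) → Y ∈ U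
  isOpen_univ X _ := ⟨∅, by simp, by simp⟩
  isOpen_inter U V hU hV X hX := by
    classical
    obtain ⟨s, hs, hs'⟩ := hU X hX.1
    obtain ⟨t, ht, ht'⟩ := hV X hX.2
    refine ⟨s ∪ t, fun p hp => (Finset.mem_union.1 hp).elim (hs p) (ht p), fun Y hY => ⟨?_, ?_⟩⟩
    · exact hs' Y fun p hp => hY p (Finset.mem_union_left _ hp)
    · exact ht' Y fun p hp => hY p (Finset.mem_union_right _ hp)
  isOpen_sUnion 𝒰 h𝒰 X := by
    rintro ⟨U, hU, hX⟩
    obtain ⟨s, hs, hs'⟩ := h𝒰 U hU X hX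
    exact ⟨s, hs, fun Y hY => ⟨U, hU, hs' Y hY⟩⟩

theorem exists_seg_subset_of_isOpen (he : ∀ p, IsVZero (degeneratePoints e p))
    {U : Set {X : Set ℕ // X.Infinite}} (hU : @IsOpen _ (segmentTopology e) U) (hne : U.Nonempty) :
    ∃ A B, IsSeg A B ∧ Seg A B ⊆ Subtype.val '' U := by
  obtain ⟨X, hX⟩ := hne
  obtain ⟨s, hs, hsU⟩ := hU X hX
  have hXs : X.1 ∈ Seg (segLower s) (segUpper s) :=
    mem_seg_segLower_segUpper.2 ⟨X.2, fun q hq => (hs q hq).1⟩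
  have hseg : IsSeg (segLower s) (segUpper s) := by
    refine ⟨hXs.2.1.trans hXs.2.2, ?_⟩
    rcases s.eq_empty_or_nonempty with rfl | hne
    · simpa [segLower, segUpper] using infinite_univ (α := ℕ)
    · obtain ⟨p, hp, hmax⟩ := s.exists_max_image e hne
      exact infinite_of_notMem_degeneratePoints e (hs p hp).2 hmax hXs
  have hv : ∀ t : Finset (Set ℕ × Set ℕ), IsVZero (⋃ p ∈ t, degeneratePoints e p) := by
    classical
    intro t
    induction t using Finset.induction_on with
    | empty => simpa using isVZero_empty
    | insert p t _ ih =>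
      rw [Finset.set_biUnion_insert]
      exact (he p).union ih
  obtain ⟨C, D, hCD, -, h⟩ := (hv s).exists_seg_subset hseg (T := Subtype.val '' U) fun Y hY => by
    have hY' := mem_seg_segLower_segUpper.1 hY.1
    exact ⟨⟨Y, hY'.1⟩, hsU _ fun p hp => ⟨hY'.2 p hp, fun h => hY.2 (mem_biUnion hp h)⟩, rfl⟩
  exact ⟨C, D, hCD, h⟩

theorem exists_isOpen_subset_seg (he : ∀ p, IsVZero (degeneratePoints e p)) (A B : Set ℕ) :
    ∃ U : Set {X : Set ℕ // X.Infinite}, @IsOpen _ (segmentTopology e) U ∧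
      Subtype.val '' U ⊆ Seg A B ∧ IsVZero (Seg A B \ Subtype.val '' U) := by
  refine ⟨{X | X.1 ∈ Seg A B \ degeneratePoints e (A, B)}, fun X hX => ⟨{(A, B)}, ?_, ?_⟩, ?_, ?_⟩
  · simpa using hX
  · intro Y hY
    simpa using hY
  · rintro _ ⟨X, hX, rfl⟩
    exact hX.1
  · exact (he (A, B)).mono fun X hX =>
      by_contra fun h => hX.2 ⟨⟨X, hX.1.1⟩, ⟨hX.1, h⟩, rfl⟩

end Ranking

open Cardinal in
theorem exists_ranking : ∃ e : Set ℕ × Set ℕ → continuum.{0}.ord.ToType,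
    ∀ p, #{q // e q ≤ e p} < 𝔠 := by
  have hcard : #(Set ℕ × Set ℕ) = #continuum.{0}.ord.ToType := by simp
  obtain ⟨e⟩ := Cardinal.eq.1 hcard
  refine ⟨e, fun p => ?_⟩
  have h : #(Iic (e p)) < 𝔠 := by
    rw [← Iio_insert]
    refine mk_insert_le.trans_lt ?_
    exact add_lt_of_lt aleph0_le_continuum (mk_Iio_toType_ord_lt _) (one_lt_aleph0.trans aleph0_lt_continuum)
  refine lt_of_le_of_lt (mk_le_of_injective (f := fun q => (⟨e q.1, q.2⟩ : Iic (e p))) ?_) h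
  intro a b hab
  exact Subtype.ext (e.injective (Subtype.mk.inj hab))

/-- There is a topology on `[ω]^ω` for which the sets with the Baire property
are exactly the v-sets. -/
theorem exists_topology_baireProperty_iff_vSet :
    ∃ τ : TopologicalSpace {X : Set ℕ // X.Infinite},
      ∀ S : Set {X : Set ℕ // X.Infinite},
        (∃ U : Set {X : Set ℕ // X.Infinite},
            @IsOpen _ τ U ∧ @IsMeagre _ τ (symmDiff S U)) ↔
          IsVSet (Subtype.val '' S) := by
  obtain ⟨e, he⟩ := exists_ranking
  have hv := fun p => isVZero_degeneratePoints e p (he p)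
  let _ := segmentTopology e
  exact ⟨segmentTopology e, baireProperty_iff_isVSet
    (fun _ hU hne => exists_seg_subset_of_isOpen e hv hU hne)
    (fun A B _ => exists_isOpen_subset_seg e hv A B)⟩
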